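/- Let m ≥ 1 be an integer and p, q real numbers with q ≠ 0, p > 0 and p² > 4(2m+3)q². Set D = √(p² − 4(2m+3)q²), r₁ = (p + D)/((2m+3)q²) and r₂ = (p − D)/((2m+3)q²). Then there exist a real number τ₀ and differentiable positive functions a, b : (τ₀, ∞) → ℝ solving the ODE system a' = 4 + 2m q² a²/b², b' = 2p − 3q² a/b, such that r₂ < a(τ)/b(τ) < r₁ for all τ > τ₀, a/b is strictly decreasing, lim_{τ→τ₀⁺} a(τ) = lim_{τ→τ₀⁺} b(τ) = 0 with lim_{τ→τ₀⁺} a(τ)/b(τ) = r₁, and lim_{τ→∞} a(τ)/b(τ) = r₂. -/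

import Mathlib

open Filter Topology in
/-- A scalar autonomous equation `W' = 1 / f W` with `f ≥ 1` continuous has a global increasing
solution through the origin. -/
lemma exists_strictMono_hasDerivAt_inv (f : ℝ → ℝ) (hf : Continuous f) (h1 : ∀ u, 1 ≤ f u) :
    ∃ W : ℝ → ℝ, W 0 = 0 ∧ StrictMono W ∧ Tendsto W atTop atTop ∧
      ∀ t, HasDerivAt W (f (W t))⁻¹ t := by
  set G : ℝ → ℝ := fun w => ∫ u in (0 : ℝ)..w, f u with hG
  have hG' : ∀ w, HasDerivAt G (f w) w := fun w => hf.integral_hasStrictDerivAt 0 w |>.hasDerivAt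
  have hG0 : G 0 = 0 := by simp [hG]
  have hmono : StrictMono G := strictMono_of_deriv_pos fun w => by
    rw [(hG' w).deriv]; linarith [h1 w]
  have hcont : Continuous G := continuous_iff_continuousAt.2 fun w => (hG' w).continuousAt
  have hsub : Monotone fun w => G w - w :=
    have h : ∀ w, HasDerivAt (fun w => G w - w) (f w - 1) w := fun w =>
      (hG' w).sub (hasDerivAt_id w)
    monotone_of_deriv_nonneg (fun w => (h w).differentiableAt) fun w => by
      rw [(h w).deriv]; linarith [h1 w]
  have htop : Tendsto G atTop atTop := by
    refine tendsto_atTop_mono' _ ?_ tendsto_id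
    filter_upwards [eventually_ge_atTop (0 : ℝ)] with w hw
    have := hsub hw
    simp only [hG0, id] at this ⊢
    linarith
  have hbot : Tendsto G atBot atBot := by
    refine tendsto_atBot_mono' _ ?_ tendsto_id
    filter_upwards [eventually_le_atBot (0 : ℝ)] with w hw
    have := hsub hw
    simp only [hG0, id] at this ⊢
    linarith
  let e : ℝ ≃o ℝ := hmono.orderIsoOfSurjective G (hcont.surjective htop hbot)
  have he : ∀ t, G (e.symm t) = t := fun t => e.apply_symm_apply t
  refine ⟨e.symm, ?_, e.symm.strictMono, e.symm.tendsto_atTop, fun t => ?_⟩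
  · rw [OrderIso.symm_apply_eq]; exact hG0.symm
  · exact (hG' (e.symm t)).of_local_left_inverse e.symm.continuous.continuousAt
      (by linarith [h1 (e.symm t)]) (Eventually.of_forall he)

/-- ODE content of the type-I ancient solution on an SU(2)-bundle over a
quaternion-Kähler manifold connecting the Einstein metric with `a/b = r₂` (at τ = ∞) to the
one with `a/b = r₁` (at the singular time). -/
theorem stmt_17 (m : ℕ) (hm : 1 ≤ m) (p q : ℝ) (hq : q ≠ 0) (hp : 0 < p)
    (hpq : p ^ 2 > 4 * (2 * (m : ℝ) + 3) * q ^ 2)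
    (D r₁ r₂ : ℝ)
    (hD : D = Real.sqrt (p ^ 2 - 4 * (2 * (m : ℝ) + 3) * q ^ 2))
    (hr₁ : r₁ = (p + D) / ((2 * (m : ℝ) + 3) * q ^ 2))
    (hr₂ : r₂ = (p - D) / ((2 * (m : ℝ) + 3) * q ^ 2)) :
    ∃ (τ₀ : ℝ) (a b : ℝ → ℝ),
      (∀ τ ∈ Set.Ioi τ₀, 0 < a τ ∧ 0 < b τ) ∧
      (∀ τ ∈ Set.Ioi τ₀,
        HasDerivAt a (4 + 2 * (m : ℝ) * q ^ 2 * (a τ) ^ 2 / (b τ) ^ 2) τ) ∧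
      (∀ τ ∈ Set.Ioi τ₀, HasDerivAt b (2 * p - 3 * q ^ 2 * (a τ / b τ)) τ) ∧
      (∀ τ ∈ Set.Ioi τ₀, r₂ < a τ / b τ ∧ a τ / b τ < r₁) ∧
      StrictAntiOn (fun τ => a τ / b τ) (Set.Ioi τ₀) ∧
      Filter.Tendsto a (nhdsWithin τ₀ (Set.Ioi τ₀)) (nhds 0) ∧
      Filter.Tendsto b (nhdsWithin τ₀ (Set.Ioi τ₀)) (nhds 0) ∧
      Filter.Tendsto (fun τ => a τ / b τ) (nhdsWithin τ₀ (Set.Ioi τ₀)) (nhds r₁) ∧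
      Filter.Tendsto (fun τ => a τ / b τ) Filter.atTop (nhds r₂) := by
  have hm' : (1 : ℝ) ≤ m := by exact_mod_cast hm
  have hq2 : 0 < q ^ 2 := by positivity
  have hD0 : 0 < D := by rw [hD]; exact Real.sqrt_pos.2 (by linarith)
  have hDD : D ^ 2 = p ^ 2 - 4 * (2 * (m : ℝ) + 3) * q ^ 2 := by
    rw [hD]; exact Real.sq_sqrt (by linarith)
  have hDp : D < p := by nlinarith
  have hn : (0 : ℝ) < 2 * m + 3 := by positivity
  have hc : 0 < (2 * (m : ℝ) + 3) * q ^ 2 := by positivity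
  have hsum : (2 * (m : ℝ) + 3) * q ^ 2 * (r₁ + r₂) = 2 * p := by
    rw [hr₁, hr₂]; field_simp; ring
  have hdiff : (2 * (m : ℝ) + 3) * q ^ 2 * (r₁ - r₂) = 2 * D := by
    rw [hr₁, hr₂]; field_simp; ring
  have hprod : (2 * (m : ℝ) + 3) * q ^ 2 * (r₁ * r₂) = 4 := by
    rw [hr₁, hr₂]; field_simp; linear_combination -hDD
  have hr₂0 : 0 < r₂ := by rw [hr₂]; exact div_pos (by linarith) hc
  have hr : 0 < r₁ - r₂ := by
    by_contra! h
    nlinarith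
  set k : ℝ := 2 * p - 3 * q ^ 2 * r₁ with hk
  have hk0 : 0 < k := by
    have hr₁0 : 0 < r₁ := by linarith
    have h₁ : (2 * (m : ℝ) + 3) * q ^ 2 * r₁ < 2 * p := by nlinarith [mul_pos hc hr₂0]
    have h₂ : 0 < q ^ 2 * r₁ * m := by positivity
    linarith
  set δ : ℝ := 2 * D / k with hδ
  have hδ0 : 0 < δ := by positivity
  set γ : ℝ := 3 / (2 * m + 3) with hγ
  have hγ0 : 0 < γ := by positivity
  have hkδ : k * δ = 2 * D := by rw [hδ]; field_simp
  have hγn : γ * (2 * m + 3) = 3 := by rw [hγ]; field_simp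
  obtain ⟨W, hW0, hWmono, hWtop, hW'⟩ :=
    exists_strictMono_hasDerivAt_inv (fun u => (1 + |u| ^ δ) ^ γ)
      ((continuous_const.add (continuous_abs.rpow_const fun _ => Or.inr hδ0.le)).rpow_const
        fun _ => Or.inr hγ0.le)
      (fun u => Real.one_le_rpow (by linarith [Real.rpow_nonneg (abs_nonneg u) δ]) hγ0.le)
  have hWpos : ∀ t ∈ Set.Ioi (0 : ℝ), 0 < W t := fun t ht => hW0 ▸ hWmono ht
  set x : ℝ → ℝ := fun t => W t ^ δ with hx
  have hxpos : ∀ t ∈ Set.Ioi (0 : ℝ), 0 < x t := fun t ht => Real.rpow_pos_of_pos (hWpos t ht) _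
  set y : ℝ → ℝ := fun t => r₂ + (r₁ - r₂) / (1 + x t) with hy
  set b : ℝ → ℝ := fun t => k * (W t * (1 + x t) ^ γ) with hb
  have hbpos : ∀ t ∈ Set.Ioi (0 : ℝ), 0 < b t := fun t ht => by
    have h₁ := hWpos t ht
    have h₂ := hxpos t ht
    simp only [hb]; positivity
  have hypos : ∀ t ∈ Set.Ioi (0 : ℝ), r₂ < y t := fun t ht => by
    have h₂ := hxpos t ht
    have : 0 < (r₁ - r₂) / (1 + x t) := by positivity
    simp only [hy]; linarith
  have hylt : ∀ t ∈ Set.Ioi (0 : ℝ), y t < r₁ := fun t ht => by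
    have h₂ := hxpos t ht
    have : (r₁ - r₂) / (1 + x t) < r₁ - r₂ := div_lt_self hr (by linarith)
    simp only [hy]; linarith
  have hratio : ∀ t ∈ Set.Ioi (0 : ℝ), y t * b t / b t = y t := fun t ht =>
    mul_div_cancel_right₀ _ (hbpos t ht).ne'
  have hx' : ∀ t ∈ Set.Ioi (0 : ℝ),
      HasDerivAt x (δ * x t / (W t * (1 + x t) ^ γ)) t := fun t ht => by
    have h₁ := hWpos t ht
    have h₂ := hxpos t ht
    have h := (hW' t).rpow_const (p := δ) (Or.inl h₁.ne')
    convert h using 1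
    rw [Real.rpow_sub_one h₁.ne', abs_of_pos h₁]
    simp only [hx] at h₂ ⊢
    field_simp
  have hb' : ∀ t ∈ Set.Ioi (0 : ℝ), HasDerivAt b (2 * p - 3 * q ^ 2 * y t) t := fun t ht => by
    have h₁ := hWpos t ht
    have h₂ := hxpos t ht
    have h := ((hW' t).mul (((hx' t ht).const_add 1).rpow_const (p := γ)
      (Or.inl (by positivity)))).const_mul k
    refine HasDerivAt.congr_deriv h ?_
    have h₃ : 0 < 1 + x t := by positivity
    rw [Real.rpow_sub_one h₃.ne', abs_of_pos h₁]
    change k * (((1 + x t) ^ γ)⁻¹ * (1 + x t) ^ γ + _) = _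
    have h₄ : 0 < (1 + x t) ^ γ := by positivity
    simp only [hy]
    field_simp
    have h₅ : 3 * q ^ 2 * (r₁ - r₂) = k * δ * γ := by
      refine mul_right_cancel₀ hn.ne' ?_
      linear_combination 3 * hdiff - (2 * m + 3) * γ * hkδ - 2 * D * hγn
    linear_combination (1 + x t) * hk - x t * h₅
  have hy' : ∀ t ∈ Set.Ioi (0 : ℝ), HasDerivAt y
      (((2 * (m : ℝ) + 3) * q ^ 2 * y t ^ 2 - 2 * p * y t + 4) / b t) t := fun t ht => by
    have h₁ := hWpos t ht
    have h₂ := hxpos t ht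
    have h₃ : 0 < 1 + x t := by positivity
    have h₄ : 0 < (1 + x t) ^ γ := by positivity
    have h := (((hasDerivAt_const t (r₁ - r₂)).div
      ((hx' t ht).const_add 1) h₃.ne').const_add r₂)
    refine HasDerivAt.congr_deriv h ?_
    have hQ : (2 * (m : ℝ) + 3) * q ^ 2 * y t ^ 2 - 2 * p * y t + 4
        = -(2 * D * (r₁ - r₂) * x t / (1 + x t) ^ 2) := by
      have : (2 * (m : ℝ) + 3) * q ^ 2 * y t ^ 2 - 2 * p * y t + 4
        = (2 * (m : ℝ) + 3) * q ^ 2 * ((y t - r₁) * (y t - r₂)) := by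
        linear_combination y t * hsum - hprod
      rw [this, ← hdiff]
      simp only [hy]
      field_simp
      ring
    rw [hQ, ← hkδ]
    simp only [hb]
    field_simp
    ring
  have hWlim : Filter.Tendsto W (nhdsWithin 0 (Set.Ioi 0)) (nhds 0) := by
    have := (hW' 0).continuousAt.tendsto
    rw [hW0] at this
    exact this.mono_left nhdsWithin_le_nhds
  have hxlim : Filter.Tendsto x (nhdsWithin 0 (Set.Ioi 0)) (nhds 0) := by
    have := hWlim.rpow_const (p := δ) (Or.inr hδ0.le)
    rwa [Real.zero_rpow hδ0.ne'] at this
  have hylim : Filter.Tendsto y (nhdsWithin 0 (Set.Ioi 0)) (nhds r₁) := by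
    have := ((tendsto_const_nhds (x := r₁ - r₂)).div (hxlim.const_add 1)
      (by norm_num)).const_add r₂
    simpa using this
  have hblim : Filter.Tendsto b (nhdsWithin 0 (Set.Ioi 0)) (nhds 0) := by
    have := (hWlim.mul ((hxlim.const_add 1).rpow_const (p := γ)
      (Or.inr hγ0.le))).const_mul k
    simpa using this
  refine ⟨0, fun t => y t * b t, b, fun t ht =>
    ⟨mul_pos (hr₂0.trans (hypos t ht)) (hbpos t ht), hbpos t ht⟩, fun t ht => ?_, fun t ht => ?_,
    fun t ht => ?_, ?_, ?_, hblim, ?_, ?_⟩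
  · have hbt := hbpos t ht
    refine ((hy' t ht).mul (hb' t ht)).congr_deriv ?_
    field_simp
    ring
  · simpa only [hratio t ht] using hb' t ht
  · simpa only [hratio t ht] using ⟨hypos t ht, hylt t ht⟩
  · intro s hs t ht hst
    have hxst : x s < x t := Real.rpow_lt_rpow (hWpos s hs).le (hWmono hst) hδ0
    have hxs := hxpos s hs
    simp only [hratio s hs, hratio t ht]
    simp only [hy]
    gcongr
  · simpa using hylim.mul hblim
  · refine hylim.congr' ?_
    filter_upwards [self_mem_nhdsWithin] with t ht using (hratio t ht).symm
  · have hxtop : Filter.Tendsto x Filter.atTop Filter.atTop :=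
      (tendsto_rpow_atTop hδ0).comp hWtop
    have hy_top : Filter.Tendsto y Filter.atTop (nhds r₂) := by
      have := ((Filter.tendsto_atTop_add_const_left _ 1 hxtop).const_div_atTop
        (r₁ - r₂)).const_add r₂
      simpa using this
    refine hy_top.congr' ?_
    filter_upwards [Filter.eventually_gt_atTop 0] with t ht using (hratio t ht).symm
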